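/- (Theorem 3.6 of Dwork–Roth, as used: the Laplace mechanism is (ε,0)-differentially private.) Let ε > 0 and Δ > 0, and for c ∈ ℝ let μ_c denote the measure on ℝ with density x ↦ ENNReal.ofReal ((ε/(2Δ)) * Real.exp (-(ε/Δ) * |x - c|)) with respect to Lebesgue measure (the Laplace distribution centered at c with scale Δ/ε). Then for all c, c' ∈ ℝ with |c - c'| ≤ Δ and every measurable set S ⊆ ℝ, μ_c S ≤ ENNReal.ofReal (Real.exp ε) * μ_{c'} S. -/

import Mathlib

open MeasureTheory

/-- The Laplace mechanism is `(ε, 0)`-differentially private: for centers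
`c, c'` with `|c - c'| ≤ Δ`, the Laplace measures with scale `Δ/ε` satisfy
`μ_c S ≤ exp ε * μ_{c'} S` for every measurable `S`. -/
theorem masked_lark_laplace_mechanism_dp (ε Δ : ℝ) (hε : 0 < ε) (hΔ : 0 < Δ)
    (c c' : ℝ) (hcc' : |c - c'| ≤ Δ) (S : Set ℝ) (hS : MeasurableSet S) :
    volume.withDensity
        (fun x => ENNReal.ofReal ((ε / (2 * Δ)) * Real.exp (-(ε / Δ) * |x - c|))) S ≤
      ENNReal.ofReal (Real.exp ε) *
        volume.withDensity
          (fun x => ENNReal.ofReal ((ε / (2 * Δ)) * Real.exp (-(ε / Δ) * |x - c'|))) S := by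
  rw [withDensity_apply _ hS, withDensity_apply _ hS,
    ← lintegral_const_mul' _ _ ENNReal.ofReal_ne_top]
  refine lintegral_mono fun x => ?_
  rw [← ENNReal.ofReal_mul (Real.exp_pos ε).le]
  refine ENNReal.ofReal_le_ofReal ?_
  rw [mul_left_comm, ← Real.exp_add]
  gcongr
  have hdist : |x - c'| ≤ |x - c| + Δ := (abs_sub_le x c c').trans (by gcongr)
  have hscaled := mul_le_mul_of_nonneg_left hdist (div_pos hε hΔ).le
  rw [mul_add, div_mul_cancel₀ ε hΔ.ne'] at hscaled
  linarith
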